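/- Let k ≥ 1 be odd and h ∈ ℤ with gcd(h,k) = 1. Then −(1/2) ∑_{n=0}^{(k−1)/2} ζ_k^{2hn} (ζ_k^h;ζ_k^{2h})_n² / (−ζ_k^{2h};ζ_k^{2h})_n = i ∑_{n=0}^{k−1} (−1)^{n(n+1)/2} ζ_k^{hn(n+1)} (ζ_k^{2h};−ζ_k^{2h})_n / (iζ_k^h;−ζ_k^{2h})_{n+1}², all denominators on both sides being nonzero. -/

import Mathlib

open scoped BigOperators Classical
open Filter Topology

noncomputable section

/-- finite q-Pochhammer symbol $(x;q)_n$ -/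
def qPoch (x q : ℂ) (n : ℕ) : ℂ := ∏ j ∈ Finset.range n, (1 - x * q ^ j)

/-- infinite q-Pochhammer symbol $(x;q)_\infty$ -/
def qPochInf (x q : ℂ) : ℂ := ∏' j : ℕ, (1 - x * q ^ j)

/-- $e(x) = e^{2\pi i x}$ -/
def ee (x : ℂ) : ℂ := Complex.exp (2 * Real.pi * Complex.I * x)

/-- $\zeta_n^m = e(m/n)$ -/
def zeta (m : ℤ) (n : ℕ) : ℂ := ee ((m : ℂ) / (n : ℂ))

/-- Dedekind eta -/
def eta (τ : ℂ) : ℂ := Complex.exp (Real.pi * Complex.I * τ / 12) * qPochInf (ee τ) (ee τ)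

/-- Jacobi theta -/
def theta (z τ : ℂ) : ℂ :=
  -Complex.I * Complex.exp (Real.pi * Complex.I * τ / 4) * Complex.exp (-(Real.pi * Complex.I * z))
    * qPochInf (ee τ) (ee τ) * qPochInf (ee z) (ee τ) * qPochInf ((ee z)⁻¹ * ee τ) (ee τ)

/-- universal mock theta function g₂ -/
def g2 (ζ q : ℂ) : ℂ :=
  ∑' n : ℕ, qPoch (-q) q n * q ^ (n * (n + 1) / 2) /
    (qPoch ζ q (n + 1) * qPoch (ζ⁻¹ * q) q (n + 1))

/-- universal mock theta function g₃ -/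
def g3 (ζ q : ℂ) : ℂ :=
  ∑' n : ℕ, q ^ (n * (n + 1)) / (qPoch ζ q (n + 1) * qPoch (ζ⁻¹ * q) q (n + 1))

/-- the series L -/
def Lser (ζ q : ℂ) : ℂ :=
  (1 / 2) * ∑' n : ℕ, q ^ n * qPoch (ζ⁻¹ * q) q n * qPoch ζ q n / qPoch (-q) q n

/-- the function M -/
def Mfun (z τ : ℂ) : ℂ :=
  -(Complex.I / 2) * Complex.exp (Real.pi * Complex.I * z) * theta z τ *
    g3 (-(ee z)) (ee τ) / (Complex.exp (Real.pi * Complex.I * τ / 12) * eta (2 * τ))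

/-- the function T -/
def Tfun (z τ : ℂ) : ℂ :=
  -Complex.I * eta (2 * τ) ^ 4 / (ee z * eta τ ^ 2 * theta (2 * z) (2 * τ))
  - Complex.I * eta (2 * τ) ^ 10 * theta (2 * z + 1 / 2) (2 * τ) /
      (2 * ee z ^ 2 * Complex.exp (Real.pi * Complex.I * τ / 2) * eta τ ^ 4 * eta (4 * τ) ^ 4 *
        theta (2 * z) (2 * τ) * theta (2 * z + τ + 1 / 2) (2 * τ))
  - Complex.I * eta (2 * τ) ^ 4 * theta z τ /
      (2 * Complex.exp (Real.pi * Complex.I * τ / 2) * ee z ^ 2 * eta (4 * τ) ^ 2 *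
        theta (z + 1 / 2) τ * theta (2 * z + τ + 1 / 2) (2 * τ))

/-- the function K -/
def Kfun (z τ : ℂ) : ℂ :=
  eta (2 * τ) ^ 4 / (Complex.I * ee z * eta τ ^ 2 * theta (2 * z) (2 * τ))

/-- Zwegers' μ-function -/
def mu (z₁ z₂ τ : ℂ) : ℂ :=
  Complex.exp (Real.pi * Complex.I * z₁) / theta z₂ τ *
    ∑' n : ℤ, (-(ee z₂)) ^ n * Complex.exp (Real.pi * Complex.I * (n : ℂ) * ((n : ℂ) + 1) * τ) /
      (1 - ee z₁ * (ee τ) ^ n)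

/-- the Appell–Lerch sum A -/
def appell (ζ q : ℂ) : ℂ :=
  ∑' n : ℤ, (-1 : ℂ) ^ n * q ^ ((3 * n * (n + 1)) / 2) / (1 + ζ * q ^ n)

/-- the function Θ -/
def bigTheta (z₁ z₂ z τ : ℂ) : ℂ :=
  (1 / (2 * Real.pi * Complex.I)) * deriv (fun w => theta w τ) 0 *
    theta (z₁ + z₂ + z) τ * theta z τ /
    (theta z₁ τ * theta z₂ τ * theta (z₁ + z) τ * theta (z₂ + z) τ)

/-- the function 𝔱 -/
def tfrak (z τ : ℂ) : ℂ :=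
  Kfun z τ - Complex.I * Kfun (z + 1 / 4) (τ + 1 / 2) +
    Complex.I * Complex.exp (-(Real.pi * Complex.I * τ / 2)) * bigTheta (2 * z) τ (1 / 2) (2 * τ)

/-- the second order mock theta function B -/
def mockB (q : ℂ) : ℂ :=
  ∑' n : ℕ, q ^ n * qPoch (-q) (q ^ 2) n / qPoch q (q ^ 2) (n + 1)

/-- Ramanujan's third order mock theta function f -/
def mockf (q : ℂ) : ℂ := ∑' n : ℕ, q ^ (n ^ 2) / qPoch (-q) q n ^ 2

/-- the modular form b -/
def bfun (q : ℂ) : ℂ := qPochInf q q / qPochInf (-q) q ^ 2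

/-- τ(t) = h/k + it/(2π) -/
def tauT (h k : ℕ) (t : ℝ) : ℂ := (h : ℂ) / (k : ℂ) + Complex.I * (t : ℂ) / (2 * Real.pi)

/-- q(t) = e^{2πiτ(t)} -/
def qT (h k : ℕ) (t : ℝ) : ℂ := ee (tauT h k t)

lemma qPoch_zero (x q : ℂ) : qPoch x q 0 = 1 := by simp [qPoch]

lemma qPoch_succ (x q : ℂ) (n : ℕ) : qPoch x q (n + 1) = qPoch x q n * (1 - x * q ^ n) := by
  simp [qPoch, Finset.prod_range_succ]

lemma qPoch_succ_left (x q : ℂ) (n : ℕ) :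
    qPoch x q (n + 1) = (1 - x) * qPoch (x * q) q n := by
  unfold qPoch
  rw [Finset.prod_range_succ', mul_comm]
  congr 1
  · simp
  · exact Finset.prod_congr rfl fun j _ => by ring

lemma qPoch_eq_zero {x q : ℂ} {j n : ℕ} (hj : j < n) (hx : x * q ^ j = 1) : qPoch x q n = 0 :=
  Finset.prod_eq_zero (Finset.mem_range.2 hj) (by rw [hx, sub_self])

lemma qPoch_ne_zero {x q : ℂ} {M : ℕ} (hq : q ^ M = 1) (hx : x ^ M ≠ 1) (n : ℕ) :
    qPoch x q n ≠ 0 := by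
  refine Finset.prod_ne_zero_iff.2 fun j _ h0 => hx ?_
  have h1 : x * q ^ j = 1 := (sub_eq_zero.1 h0).symm
  have h2 : (x * q ^ j) ^ M = x ^ M := by
    rw [mul_pow, ← pow_mul, mul_comm j M, pow_mul, hq, one_pow, mul_one]
  rw [← h2, h1, one_pow]

/-- The truncated series `∑ qⁿ (u;q)ₙ (q/u;q)ₙ / (-q;q)ₙ`. -/
def lSum (q : ℂ) (k : ℕ) (u : ℂ) : ℂ :=
  ∑ n ∈ Finset.range k, q ^ n * (qPoch u q n * qPoch (q / u) q n) / qPoch (-q) q n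

/-- The truncation of the series defining the universal mock theta function `g₂`. -/
def gSum (Q : ℂ) (k : ℕ) (z : ℂ) : ℂ :=
  ∑ n ∈ Finset.range k, Q ^ (n * (n + 1) / 2) * qPoch (-Q) Q n /
    (qPoch z Q (n + 1) * qPoch (Q / z) Q (n + 1))

lemma lSum_telescope {q u : ℂ} (hu : u ≠ 0) (hq : ∀ n, qPoch (-q) q n ≠ 0)
    (hq0 : q ≠ 0) (N : ℕ) :
    u ^ 2 * lSum q (N + 1) u + lSum q (N + 1) (u * q) =
      2 * u + (1 - u) ^ 2 * (qPoch (u * q) q N * qPoch (q / u) q N) / qPoch (-q) q N := by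
  have hdiv : q / (u * q) = 1 / u := by field_simp
  unfold lSum
  rw [hdiv]
  induction N with
  | zero => simp [qPoch_zero]; ring
  | succ N ih =>
    rw [Finset.sum_range_succ _ (N + 1), Finset.sum_range_succ _ (N + 1)]
    have e1 := qPoch_succ_left u q N
    have e2 := qPoch_succ_left (1 / u) q N
    have e3 := qPoch_succ (u * q) q N
    have e4 := qPoch_succ (q / u) q N
    have e5 := qPoch_succ (-q) q N
    have h1 := hq N
    have h2 := hq (N + 1)
    rw [e5] at h2
    have h3 : 1 + q * q ^ N ≠ 0 := by simpa using right_ne_zero_of_mul h2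
    rw [show 1 / u * q = q / u by ring] at e2
    rw [mul_add, add_add_add_comm, ih, e1, e2, e3, e4, e5]
    generalize qPoch (u * q) q N = A at *
    generalize qPoch (q / u) q N = B at *
    generalize qPoch (-q) q N = D at *
    rw [neg_mul, sub_neg_eq_add]
    rw [pow_succ q N]
    generalize q ^ N = X at *
    rw [mul_comm q X] at *
    field_simp
    ring

lemma lSum_shift {q u : ℂ} {k : ℕ} (hk : Odd k) (hq : q ^ k = 1) (hu : u ^ k = 1)
    (hz : ∃ j < k, u * q ^ j = 1) :
    lSum q k (u * q) = 2 * u - u ^ 2 * lSum q k u := by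
  have hk0 : k ≠ 0 := hk.pos.ne'
  have hu0 : u ≠ 0 := by rintro rfl; simp [hk0] at hu
  have hq0 : q ≠ 0 := by rintro rfl; simp [hk0] at hq
  obtain ⟨j, hj, hj1⟩ := hz
  obtain ⟨N, rfl⟩ := Nat.exists_eq_succ_of_ne_zero hk0
  have hne : ∀ n, qPoch (-q) q n ≠ 0 := qPoch_ne_zero hq (by rw [hk.neg_pow, hq]; norm_num)
  have h1 := lSum_telescope hu0 hne hq0 N
  have h2 : (1 - u) * qPoch (u * q) q N = 0 := by
    rw [← qPoch_succ_left]; exact qPoch_eq_zero hj hj1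
  have h3 : (1 - u) ^ 2 * (qPoch (u * q) q N * qPoch (q / u) q N) = 0 := by
    linear_combination (1 - u) * qPoch (q / u) q N * h2
  rw [h3, zero_div] at h1
  linear_combination h1

lemma triangle_succ (n : ℕ) : (n + 1) * (n + 1 + 1) / 2 = n * (n + 1) / 2 + (n + 1) := by
  rw [show (n + 1) * (n + 1 + 1) = n * (n + 1) + 2 * (n + 1) by ring,
    Nat.add_mul_div_left _ _ two_pos]

lemma gSum_telescope {Q z : ℂ} {M : ℕ} (hM : M ≠ 0) (hQ : Q ^ M = 1) (hz0 : z ≠ 0)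
    (hz : z ^ M ≠ 1) (N : ℕ) :
    z ^ 2 * gSum Q N z + gSum Q N (z * Q) =
      z * (Q ^ (N * (N + 1) / 2) * qPoch (-Q) Q N /
        (qPoch (z * Q) Q N * qPoch (Q / z) Q N) - 1) := by
  have hQ0 : Q ≠ 0 := by rintro rfl; simp [hM] at hQ
  have hdiv : Q / (z * Q) = 1 / z := by field_simp
  have hA : ∀ n, qPoch (z * Q) Q n ≠ 0 :=
    qPoch_ne_zero hQ (by rw [mul_pow, hQ, mul_one]; exact hz)
  have hB : ∀ n, qPoch (Q / z) Q n ≠ 0 :=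
    qPoch_ne_zero hQ (by rw [div_pow, hQ]; simpa using hz)
  have hz1 : 1 - z ≠ 0 := sub_ne_zero.2 (by rintro rfl; simp at hz)
  have hz2 : z - 1 ≠ 0 := sub_ne_zero.2 (by rintro rfl; simp at hz)
  unfold gSum
  rw [hdiv]
  induction N with
  | zero => simp [qPoch_zero]
  | succ N ih =>
    rw [Finset.sum_range_succ, Finset.sum_range_succ]
    have e1 := qPoch_succ_left z Q N
    have e2 := qPoch_succ_left (1 / z) Q N
    have e3 := qPoch_succ (z * Q) Q N
    have e4 := qPoch_succ (Q / z) Q N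
    have e5 := qPoch_succ (-Q) Q N
    have a0 := hA N
    have b0 := hB N
    have a1 := hA (N + 1)
    have b1 := hB (N + 1)
    rw [e3] at a1
    rw [e4] at b1
    replace a1 := right_ne_zero_of_mul a1
    replace b1 := right_ne_zero_of_mul b1
    rw [show 1 / z * Q = Q / z by ring] at e2
    rw [mul_add, add_add_add_comm, ih, e1, e2, e3, e4, e5, triangle_succ, pow_add, pow_succ Q N]
    generalize qPoch (z * Q) Q N = A at *
    generalize qPoch (Q / z) Q N = B at *
    generalize qPoch (-Q) Q N = D at *
    generalize Q ^ (N * (N + 1) / 2) = T at *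
    generalize Q ^ N = X at *
    have b2 : z - Q * X ≠ 0 := by
      intro h0; apply b1; field_simp; rw [h0, mul_zero]
    field_simp
    ring

lemma gSum_shift {Q z : ℂ} {k : ℕ} (hk : Odd k) (hQ : Q ^ k = -1) (hz0 : z ≠ 0)
    (hz : z ^ (2 * k) ≠ 1) : gSum Q k (z * Q) = -z - z ^ 2 * gSum Q k z := by
  have hk0 : k ≠ 0 := hk.pos.ne'
  have hQ2 : Q ^ (2 * k) = 1 := by rw [mul_comm, pow_mul, hQ]; norm_num
  have h1 := gSum_telescope (by omega) hQ2 hz0 hz k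
  have h2 : qPoch (-Q) Q k = 0 := by
    refine qPoch_eq_zero (j := k - 1) (by omega) ?_
    rw [neg_mul, mul_pow_sub_one hk0, hQ, neg_neg]
  rw [h2, mul_zero, zero_div] at h1
  linear_combination h1

/-- Iterating `f (z Q) = -z² f z` along a full period. -/
lemma iterate_shift {f : ℂ → ℂ} {Q z : ℂ} {k : ℕ} (hk : Odd k) (hQ : (Q ^ k) ^ (k - 1) = 1)
    (hf : ∀ n, f (z * Q ^ n * Q) = -(z * Q ^ n) ^ 2 * f (z * Q ^ n)) :
    f (z * Q ^ k) = -z ^ (2 * k) * f z := by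
  have h : ∀ n, f (z * Q ^ n) = (∏ j ∈ Finset.range n, -(z * Q ^ j) ^ 2) * f z := by
    intro n
    induction n with
    | zero => simp
    | succ n ih => rw [pow_succ, ← mul_assoc, hf, ih, Finset.prod_range_succ]; ring
  rw [h, Finset.prod_neg, Finset.prod_pow, Finset.prod_mul_distrib, Finset.prod_pow_eq_pow_sum]
  simp only [Finset.card_range, Finset.prod_const, hk.neg_one_pow]
  rw [mul_pow, ← pow_mul, ← pow_mul, Finset.sum_range_id_mul_two, pow_mul Q, hQ, mul_comm k 2]
  ring

lemma gSum_neg {Q z : ℂ} {k : ℕ} (hk : Odd k) (hQ : Q ^ k = -1) (hz0 : z ≠ 0)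
    (hz : z ^ (2 * k) ≠ 1) : gSum Q k (-z) = -gSum Q k z := by
  have hk0 : k ≠ 0 := hk.pos.ne'
  have hQ0 : Q ≠ 0 := by rintro rfl; simp [hk0] at hQ
  have hQ2 : Q ^ (2 * k) = 1 := by rw [mul_comm, pow_mul, hQ]; norm_num
  have hev : Even (2 * k) := even_two_mul k
  have generic : ∀ w : ℂ, w ≠ 0 → w ^ (2 * k) ≠ 1 → w ^ (2 * k) ≠ -1 →
      gSum Q k w + gSum Q k (-w) = 0 := by
    intro w hw0 hw hw'
    have key := iterate_shift (f := fun x => gSum Q k x + gSum Q k (-x)) (Q := Q) (z := w) hk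
      (by rw [hQ]; exact (Nat.Odd.sub_odd hk odd_one).neg_one_pow) (by
        intro n
        have hn0 : w * Q ^ n ≠ 0 := mul_ne_zero hw0 (pow_ne_zero _ hQ0)
        have hn : (w * Q ^ n) ^ (2 * k) ≠ 1 := by
          rw [mul_pow, ← pow_mul, mul_comm n, pow_mul Q, hQ2, one_pow, mul_one]; exact hw
        have h1 := gSum_shift hk hQ hn0 hn
        have h2 := gSum_shift hk hQ (neg_ne_zero.2 hn0) (by rw [hev.neg_pow]; exact hn)
        rw [neg_mul] at h2
        rw [h1, h2]
        ring)
    simp only [hQ, mul_neg, mul_one, neg_neg] at key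
    have h3 : (1 + w ^ (2 * k)) * (gSum Q k w + gSum Q k (-w)) = 0 := by
      linear_combination key
    refine (mul_eq_zero.1 h3).resolve_left fun h4 => hw' ?_
    linear_combination h4
  have hcont : ∀ w : ℂ, w ≠ 0 → w ^ (2 * k) ≠ 1 → ContinuousAt (gSum Q k) w := by
    intro w hw0 hw
    have h1 := fun n => qPoch_ne_zero hQ2 hw n
    have h2 := fun n => qPoch_ne_zero (x := Q / w) hQ2
      (by rw [div_pow, hQ2]; simpa using hw) n
    have hd : ContinuousAt (fun x : ℂ => Q / x) w := continuousAt_const.div continuousAt_id hw0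
    have hp : ∀ n, Continuous fun x : ℂ => qPoch x Q n := by
      intro n; unfold qPoch; fun_prop
    unfold gSum
    refine tendsto_finsetSum _ fun n _ => ?_
    refine ContinuousAt.div continuousAt_const ?_ (mul_ne_zero (h1 _) (h2 _))
    exact (hp _).continuousAt.mul
      (ContinuousAt.comp (f := fun x : ℂ => Q / x) (hp (n + 1)).continuousAt hd)
  have hc : ContinuousAt (fun x => gSum Q k x + gSum Q k (-x)) z :=
    (hcont z hz0 hz).add (ContinuousAt.comp (f := fun x : ℂ => -x)
      (hcont (-z) (neg_ne_zero.2 hz0) (by rw [hev.neg_pow]; exact hz)) continuousAt_neg)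
  have hpow : Continuous fun x : ℂ => x ^ (2 * k) := by fun_prop
  have hroots : ∀ᶠ x in 𝓝[≠] z, x ^ (2 * k) ≠ -1 := by
    have hfin : {x : ℂ | x ^ (2 * k) = -1}.Finite := by
      refine (Polynomial.nthRoots (2 * k) (-1 : ℂ)).toFinset.finite_toSet.subset fun x hx => ?_
      simpa [Polynomial.mem_nthRoots (show 0 < 2 * k by omega)] using hx
    have h5 : ({x : ℂ | x ^ (2 * k) = -1} \ {z})ᶜ ∈ 𝓝 z :=
      (hfin.subset Set.sdiff_subset).isClosed.isOpen_compl.mem_nhds (by simp)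
    filter_upwards [mem_nhdsWithin_of_mem_nhds h5, self_mem_nhdsWithin] with x hx hxz h6
    exact hx ⟨h6, hxz⟩
  have hev0 : ∀ᶠ x in 𝓝[≠] z, gSum Q k x + gSum Q k (-x) = 0 := by
    filter_upwards [hroots, mem_nhdsWithin_of_mem_nhds (isOpen_ne.mem_nhds hz0),
      mem_nhdsWithin_of_mem_nhds ((isOpen_ne.preimage hpow).mem_nhds hz)] with x h1 h2 h3
    exact generic x h2 h3 h1
  have hlim : Tendsto (fun x => gSum Q k x + gSum Q k (-x)) (𝓝[≠] z) (𝓝 0) :=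
    tendsto_const_nhds.congr' (hev0.mono fun x hx => hx.symm)
  have h0 := tendsto_nhds_unique (hc.tendsto.mono_left nhdsWithin_le_nhds) hlim
  linear_combination h0

/-- The two truncated series agree at roots of unity of odd order. -/
lemma two_mul_gSum_eq_lSum {y : ℂ} {k : ℕ} (hk : Odd k) (hy : y ^ k = 1) :
    2 * gSum (-y ^ 2) k (Complex.I * y) = Complex.I * lSum (y ^ 2) k y := by
  have hk0 : k ≠ 0 := hk.pos.ne'
  have hy0 : y ≠ 0 := by rintro rfl; simp [hk0] at hy
  have hq : (y ^ 2) ^ k = 1 := by rw [← pow_mul, mul_comm, pow_mul, hy, one_pow]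
  have hQ : (-y ^ 2) ^ k = -1 := by rw [hk.neg_pow, hq]
  have key := iterate_shift
    (f := fun u => 2 * gSum (-y ^ 2) k (Complex.I * u) - Complex.I * lSum (y ^ 2) k u)
    (Q := y ^ 2) (z := y) hk (by rw [hq, one_pow]) (by
      intro n
      obtain ⟨m, hm⟩ := hk
      have hk : Odd k := ⟨m, hm⟩
      set u := y * (y ^ 2) ^ n with hu
      have huk : u ^ k = 1 := by
        rw [hu, mul_pow, hy, ← pow_mul, mul_comm n, pow_mul, hq, one_pow, one_mul]
      have hu0 : u ≠ 0 := mul_ne_zero hy0 (pow_ne_zero _ (pow_ne_zero _ hy0))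
      have hz0 : Complex.I * u ≠ 0 := mul_ne_zero Complex.I_ne_zero hu0
      have hz : (Complex.I * u) ^ (2 * k) = -1 := by
        rw [mul_pow, pow_mul, Complex.I_sq, hk.neg_one_pow, mul_comm 2 k, pow_mul, huk]
        norm_num
      have hz1 : (Complex.I * u) ^ (2 * k) ≠ 1 := by rw [hz]; norm_num
      have hj : ∃ j < k, u * (y ^ 2) ^ j = 1 := by
        refine ⟨(m + (k - 1) * n) % k, Nat.mod_lt _ (Nat.pos_of_ne_zero hk0), ?_⟩
        rw [← pow_eq_pow_mod _ hq, hu, ← pow_mul, ← pow_mul, ← pow_succ', ← pow_add]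
        have hexp : 2 * n + 1 + 2 * (m + (k - 1) * n) = k * (2 * n + 1) := by
          obtain ⟨l, rfl⟩ := Nat.exists_eq_succ_of_ne_zero hk0
          simp only [Nat.succ_eq_add_one, Nat.add_sub_cancel] at hm ⊢
          rw [show l = 2 * m by omega]
          ring
        rw [hexp, pow_mul, hy, one_pow]
      have h1 := lSum_shift hk hq huk hj
      have h2 := gSum_shift hk hQ hz0 hz1
      have h3 := gSum_neg hk hQ (z := Complex.I * u * -y ^ 2)
        (mul_ne_zero hz0 (neg_ne_zero.2 (pow_ne_zero _ hy0)))
        (by rw [mul_pow, hz, mul_comm 2 k, pow_mul, hQ]; norm_num)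
      rw [show -(Complex.I * u * -y ^ 2) = Complex.I * (u * y ^ 2) by ring, h2] at h3
      rw [h1, h3]
      linear_combination 2 * u ^ 2 * gSum (-y ^ 2) k (Complex.I * u) * Complex.I_sq)
  simp only [hq, mul_one] at key
  rw [mul_comm 2 k, pow_mul, hy, one_pow] at key
  linear_combination (1 / 2) * key

lemma zeta_pow_eq_one (h : ℤ) {k : ℕ} (hk : k ≠ 0) : zeta h k ^ k = 1 := by
  have hk' : (k : ℂ) ≠ 0 := Nat.cast_ne_zero.2 hk
  rw [zeta, ee, ← Complex.exp_nat_mul, Complex.exp_eq_one_iff]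
  exact ⟨h, by field_simp⟩

lemma zeta_two_mul (h : ℤ) (k : ℕ) : zeta (2 * h) k = zeta h k ^ 2 := by
  rw [zeta, zeta, ee, ee, ← Complex.exp_nat_mul]
  congr 1
  push_cast
  ring

/-- The curious identity (6.2) for odd k. -/
theorem statement17 (k : ℕ) (hk : 1 ≤ k) (hodd : Odd k) (h : ℤ) (hghk : Int.gcd h k = 1) :
    (∀ n : ℕ, n ≤ (k - 1) / 2 →
      qPoch (-(zeta (2 * h) k)) (zeta (2 * h) k) n ≠ 0) ∧
    (∀ n : ℕ, n < k →
      qPoch (Complex.I * zeta h k) (-(zeta (2 * h) k)) (n + 1) ≠ 0) ∧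
    -(1 / 2) * ∑ n ∈ Finset.range ((k - 1) / 2 + 1),
        (zeta (2 * h) k) ^ n * qPoch (zeta h k) (zeta (2 * h) k) n ^ 2 /
          qPoch (-(zeta (2 * h) k)) (zeta (2 * h) k) n =
      Complex.I * ∑ n ∈ Finset.range k,
        (-1 : ℂ) ^ (n * (n + 1) / 2) * (zeta h k) ^ (n * (n + 1)) *
          qPoch (zeta (2 * h) k) (-(zeta (2 * h) k)) n /
          qPoch (Complex.I * zeta h k) (-(zeta (2 * h) k)) (n + 1) ^ 2 := by
  have hk0 : k ≠ 0 := hodd.pos.ne'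
  have hy := zeta_pow_eq_one h hk0
  rw [zeta_two_mul]
  generalize zeta h k = y at *
  have hy0 : y ≠ 0 := by rintro rfl; simp [hk0] at hy
  have hq : (y ^ 2) ^ k = 1 := by rw [← pow_mul, mul_comm, pow_mul, hy, one_pow]
  have hQ2 : (-y ^ 2) ^ (2 * k) = 1 := by rw [pow_mul, neg_sq, ← pow_mul, mul_comm, pow_mul, hq,
    one_pow]
  refine ⟨fun n _ => qPoch_ne_zero hq (by rw [hodd.neg_pow, hq]; norm_num) n,
    fun n _ => qPoch_ne_zero hQ2 ?_ _, ?_⟩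
  · rw [mul_pow, pow_mul, Complex.I_sq, hodd.neg_one_pow, mul_comm 2 k, pow_mul, hy]
    norm_num
  have hl : ∑ n ∈ Finset.range ((k - 1) / 2 + 1),
      (y ^ 2) ^ n * qPoch y (y ^ 2) n ^ 2 / qPoch (-y ^ 2) (y ^ 2) n = lSum (y ^ 2) k y := by
    obtain ⟨m, hm⟩ := hodd
    unfold lSum
    rw [show y ^ 2 / y = y by field_simp]
    simp only [← sq]
    refine Finset.sum_subset (Finset.range_mono (by omega)) fun n _ hn => ?_
    rw [Finset.mem_range, not_lt] at hn
    rw [qPoch_eq_zero (x := y) (j := m) (by omega)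
      (by rw [← pow_mul, ← pow_succ', ← hm, hy])]
    simp
  have hg : ∑ n ∈ Finset.range k, (-1 : ℂ) ^ (n * (n + 1) / 2) * y ^ (n * (n + 1)) *
      qPoch (y ^ 2) (-y ^ 2) n / qPoch (Complex.I * y) (-y ^ 2) (n + 1) ^ 2 =
      gSum (-y ^ 2) k (Complex.I * y) := by
    unfold gSum
    have hdiv : -y ^ 2 / (Complex.I * y) = Complex.I * y := by
      field_simp [Complex.I_ne_zero]
      simp
    rw [hdiv]
    refine Finset.sum_congr rfl fun n _ => ?_
    have h2 : 2 * (n * (n + 1) / 2) = n * (n + 1) :=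
      Nat.mul_div_cancel' (Nat.even_mul_succ_self n).two_dvd
    rw [neg_neg, neg_pow (y ^ 2) (n * (n + 1) / 2), ← pow_mul, h2, ← sq]
  rw [hl, hg]
  have key := two_mul_gSum_eq_lSum hodd hy
  linear_combination (-Complex.I / 2) * key - (1 / 2) * lSum (y ^ 2) k y * Complex.I_sq

end
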